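/- arXiv:2601.18409 — 4 statements merged into one kernel-verified Lean document; each statement's English description precedes it below -/
import Mathlib

section
/- Fix an integer k ≥ 2 and a real number α with 0 < α < 1 - 1/k. Define Γ_k^*(α) as the supremum of the set {Γ : ℝ | Γ ≥ 0 and |μ_k(c;α)| ≤ 1 for all c ∈ [0,Γ]}. Then Γ_k^*(α) > 0, and moreover |μ_k(c;α)| ≤ 1 for every c ∈ [0, Γ_k^*(α)]. -/
/-- LookAhead modal multiplier `μ_k(c; α) = (1-α) + α (1 - i c)^k`. -/
noncomputable def molaMu (k : ℕ) (α c : ℝ) : ℂ :=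
  (1 - (α : ℂ)) + (α : ℂ) * (1 - Complex.I * (c : ℂ)) ^ k


theorem mola_expand (k : ℕ) : ∃ R : ℝ → ℂ, Continuous R ∧ ∀ c : ℝ,
    (1 - Complex.I * (c : ℂ)) ^ k =
      1 - k * Complex.I * c - (k * (k - 1) / 2 : ℂ) * c ^ 2 + c ^ 3 * R c := by
  induction k with
  | zero => exact ⟨fun _ => 0, continuous_const, fun c => by simp⟩
  | succ k ih =>
    obtain ⟨R, hR, h⟩ := ih
    refine ⟨fun c => R c * (1 - Complex.I * c) + Complex.I * (k * (k - 1) / 2 : ℂ),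
      by fun_prop, fun c => ?_⟩
    rw [pow_succ, h]
    push_cast
    linear_combination (k * (c : ℂ) ^ 2) * Complex.I_sq

theorem mola_normSq (k : ℕ) (α : ℝ) : ∃ S : ℝ → ℝ, Continuous S ∧ ∀ c : ℝ,
    ‖molaMu k α c‖ ^ 2 = 1 + c ^ 2 * (α * (α * k ^ 2 - k * (k - 1)) + c * S c) := by
  obtain ⟨R, hR, h⟩ := mola_expand k
  have hre : Continuous fun c => (R c).re := Complex.continuous_re.comp hR
  have him : Continuous fun c => (R c).im := Complex.continuous_im.comp hR
  refine ⟨fun c => 2 * α * (R c).re + c * (-(α * (k * (k - 1) / 2)) + α * c * (R c).re) ^ 2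
    - 2 * α ^ 2 * k * c * (R c).im + α ^ 2 * c ^ 3 * (R c).im ^ 2, by fun_prop, fun c => ?_⟩
  have e : molaMu k α c = ((1 - α * (k * (k - 1) / 2) * c ^ 2 + α * c ^ 3 * (R c).re : ℝ) : ℂ)
      + ((-(α * k * c) + α * c ^ 3 * (R c).im : ℝ) : ℂ) * Complex.I := by
    rw [molaMu, h]
    push_cast
    linear_combination (-(α * c ^ 3) : ℂ) * (Complex.re_add_im (R c))
  rw [← Complex.normSq_eq_norm_sq, e, Complex.normSq_add_mul_I]
  ring

theorem mola_continuous (k : ℕ) (α : ℝ) : Continuous fun c : ℝ => ‖molaMu k α c‖ := by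
  unfold molaMu
  fun_prop

theorem mola_bound (k : ℕ) (hk : 2 ≤ k) (α : ℝ) (h0 : 0 < α) (h1 : α < 1) (c : ℝ)
    (hc : 0 ≤ c) (h : ‖molaMu k α c‖ ≤ 1) : c ≤ 2 / α := by
  rw [le_div_iff₀ h0]
  by_cases hc1 : c ≤ 1
  · nlinarith
  push Not at hc1
  have a1 : c ≤ ‖(1 - Complex.I * (c : ℂ))‖ := by
    have := Complex.abs_im_le_norm (1 - Complex.I * (c : ℂ))
    simpa [abs_of_nonneg hc] using this
  have a2 : c ≤ ‖(1 - Complex.I * (c : ℂ))‖ ^ k :=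
    a1.trans (le_self_pow₀ (by linarith) (by omega))
  have a3 : (α : ℂ) * (1 - Complex.I * (c : ℂ)) ^ k = molaMu k α c - ((1 - α : ℝ) : ℂ) := by
    unfold molaMu; push_cast; ring
  have a4 := norm_sub_le (molaMu k α c) ((1 - α : ℝ) : ℂ)
  rw [← a3, norm_mul, norm_pow, Complex.norm_real, Complex.norm_real, Real.norm_eq_abs,
    Real.norm_eq_abs, abs_of_pos h0, abs_of_pos (by linarith : 0 < 1 - α)] at a4
  nlinarith [mul_le_mul_of_nonneg_left a2 h0.le]

theorem mola_budget_pos_and_nonexpansive (k : ℕ) (hk : 2 ≤ k) (α : ℝ)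
    (hα0 : 0 < α) (hα1 : α < 1 - 1 / (k : ℝ)) :
    0 < sSup {Γ : ℝ | 0 ≤ Γ ∧ ∀ c ∈ Set.Icc (0 : ℝ) Γ, ‖molaMu k α c‖ ≤ 1} ∧
    ∀ c ∈ Set.Icc (0 : ℝ)
        (sSup {Γ : ℝ | 0 ≤ Γ ∧ ∀ c ∈ Set.Icc (0 : ℝ) Γ, ‖molaMu k α c‖ ≤ 1}),
      ‖molaMu k α c‖ ≤ 1 := by
  have hkpos : (0 : ℝ) < k := by exact_mod_cast (by omega : 0 < k)
  have hlt1 : α < 1 := by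
    have : 0 < 1 / (k : ℝ) := by positivity
    linarith
  set A := {Γ : ℝ | 0 ≤ Γ ∧ ∀ c ∈ Set.Icc (0 : ℝ) Γ, ‖molaMu k α c‖ ≤ 1} with hA
  have hbdd : BddAbove A :=
    ⟨2 / α, fun Γ hΓ => mola_bound k hk α hα0 hlt1 Γ hΓ.1 (hΓ.2 Γ ⟨hΓ.1, le_rfl⟩)⟩
  have hex : ∃ ε > 0, ε ∈ A := by
    obtain ⟨S, hS, h⟩ := mola_normSq k α
    have hneg : α * (α * k ^ 2 - k * (k - 1)) < 0 := by
      apply mul_neg_of_pos_of_neg hα0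
      have : α * k ^ 2 < (1 - 1 / (k : ℝ)) * k ^ 2 := by gcongr
      have e : (1 - 1 / (k : ℝ)) * k ^ 2 = k * (k - 1) := by field_simp
      linarith
    have hcont : Continuous fun c => α * (α * k ^ 2 - k * (k - 1)) + c * S c := by fun_prop
    have hev : ∀ᶠ c in nhds (0 : ℝ), α * (α * k ^ 2 - k * (k - 1)) + c * S c < 0 :=
      hcont.continuousAt.eventually_lt continuousAt_const (by simpa using hneg)
    obtain ⟨ε, hε, hball⟩ := Metric.eventually_nhds_iff.1 hev
    refine ⟨ε / 2, by positivity, by positivity, fun c hc => ?_⟩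
    have hh := hball (y := c) (by
      rw [Real.dist_eq, sub_zero, abs_of_nonneg hc.1]; linarith [hc.2])
    have h2 := h c
    have : ‖molaMu k α c‖ ^ 2 ≤ 1 := by nlinarith [sq_nonneg c]
    exact (sq_le_one_iff₀ (norm_nonneg _)).1 this
  obtain ⟨ε, hε, hεA⟩ := hex
  have hpos : 0 < sSup A := hε.trans_le (le_csSup hbdd hεA)
  refine ⟨hpos, ?_⟩
  have hclosed : IsClosed {c : ℝ | ‖molaMu k α c‖ ≤ 1} :=
    isClosed_le (mola_continuous k α) continuous_const
  have hsub : Set.Ico 0 (sSup A) ⊆ {c : ℝ | ‖molaMu k α c‖ ≤ 1} := by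
    intro c hc
    obtain ⟨Γ, hΓ, hcΓ⟩ := exists_lt_of_lt_csSup ⟨ε, hεA⟩ hc.2
    exact hΓ.2 c ⟨hc.1, hcΓ.le⟩
  have := hclosed.closure_subset_iff.2 hsub
  rw [closure_Ico hpos.ne] at this
  exact fun c hc => this hc
end

section
/- Let k ≥ 2 be an integer and α a real number with 0 < α < 1 - 1/k. Then there exists ε > 0 such that for every real c with 0 < c ≤ ε, one has |μ_k(c;α)| < 1. -/
theorem mola_pow_expand (k : ℕ) : ∃ p q : ℝ → ℝ, Continuous p ∧ Continuous q ∧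
    ∀ c : ℝ, (1 - Complex.I * (c : ℂ)) ^ k =
      ⟨1 - (k : ℝ) * (k - 1) / 2 * c ^ 2 + c ^ 3 * p c, -(k : ℝ) * c + c ^ 2 * q c⟩ := by
  induction k with
  | zero =>
    refine ⟨fun _ => 0, fun _ => 0, continuous_const, continuous_const, fun c => ?_⟩
    apply Complex.ext <;> simp
  | succ k ih =>
    obtain ⟨p, q, hp, hq, h⟩ := ih
    refine ⟨fun c => p c + q c, fun c => q c + (k : ℝ) * (k - 1) / 2 * c - c ^ 2 * p c,
      by fun_prop, by fun_prop, fun c => ?_⟩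
    rw [pow_succ, h c]
    apply Complex.ext
    · simp only [Complex.mul_re, Complex.sub_re, Complex.sub_im, Complex.one_re, Complex.one_im,
        Complex.mul_im, Complex.I_re, Complex.I_im, Complex.ofReal_re, Complex.ofReal_im]
      push_cast
      ring
    · simp only [Complex.mul_re, Complex.sub_re, Complex.sub_im, Complex.one_re, Complex.one_im,
        Complex.mul_im, Complex.I_re, Complex.I_im, Complex.ofReal_re, Complex.ofReal_im]
      push_cast
      ring

theorem mola_positive_stability_window (k : ℕ) (hk : 2 ≤ k) (α : ℝ)
    (hα0 : 0 < α) (hα1 : α < 1 - 1 / (k : ℝ)) :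
    ∃ ε > (0 : ℝ), ∀ c : ℝ, 0 < c → c ≤ ε → ‖molaMu k α c‖ < 1 := by
  obtain ⟨p, q, hp, hq, h⟩ := mola_pow_expand k
  have hk0 : (0 : ℝ) < k := by
    have : 0 < k := by omega
    exact_mod_cast this
  let G : ℝ → ℝ := fun c => -(α * (k * (k - 1))) + 2 * α * c * p c
    + c ^ 2 * (-(α * (k * (k - 1) / 2)) + α * c * p c) ^ 2 + α ^ 2 * (-(k : ℝ) + c * q c) ^ 2
  have hG : Continuous G := by fun_prop
  have hG0 : G 0 < 0 := by
    have h1 : α * k < k - 1 := by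
      have := mul_lt_mul_of_pos_right hα1 hk0
      rwa [sub_mul, one_div, inv_mul_cancel₀ hk0.ne', one_mul] at this
    have h2 : G 0 = -(α * k * ((k - 1) - α * k)) := by simp only [G]; ring
    rw [h2]
    have : 0 < α * k * ((k - 1) - α * k) := mul_pos (mul_pos hα0 hk0) (by linarith)
    linarith
  have hev := hG.continuousAt.eventually_lt_const hG0
  obtain ⟨δ, hδ, hd⟩ := Metric.eventually_nhds_iff.1 hev
  refine ⟨δ / 2, by positivity, fun c hc hc2 => ?_⟩
  have hGc : G c < 0 := hd (by rw [Real.dist_eq, sub_zero, abs_of_pos hc]; linarith)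
  have hn : ‖molaMu k α c‖ ^ 2 = 1 + c ^ 2 * G c := by
    rw [← Complex.normSq_eq_norm_sq, molaMu, h c, Complex.normSq_apply]
    simp only [Complex.add_re, Complex.add_im, Complex.mul_re, Complex.sub_re, Complex.sub_im,
      Complex.one_re, Complex.one_im, Complex.mul_im, Complex.ofReal_re, Complex.ofReal_im, G]
    ring
  have : c ^ 2 * G c < 0 := mul_neg_of_pos_of_neg (by positivity) hGc
  nlinarith [norm_nonneg (molaMu k α c)]
end

section
/- Let k be a natural number and α, γ, ω real numbers. Let J be the 2×2 real matrix with rows (0, 1) and (-1, 0), and let M := (1-α)·I + α·(I - (γω)·J)^k, where I is the 2×2 identity matrix and the power is the k-th matrix power. Then for every vector v in Euclidean space ℝ², ‖M·v‖ = |(1-α) + α·(1 - i·γω)^k| · ‖v‖, where ‖·‖ is the Euclidean norm and |·| the complex modulus. -/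
theorem mola_aux_pow (c : ℝ) (k : ℕ) :
    (!![1, -c; c, 1] : Matrix (Fin 2) (Fin 2) ℝ) ^ k =
      !![((1 - Complex.I * (c : ℂ)) ^ k).re, ((1 - Complex.I * (c : ℂ)) ^ k).im;
        -((1 - Complex.I * (c : ℂ)) ^ k).im, ((1 - Complex.I * (c : ℂ)) ^ k).re] := by
  induction k with
  | zero => simp [Matrix.one_fin_two]
  | succ n ih =>
    rw [pow_succ, ih, pow_succ (1 - Complex.I * (c : ℂ)) n, Matrix.mul_fin_two]
    ext i j
    fin_cases i <;> fin_cases j <;> simp <;> ring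

theorem mola_aux_norm (z : ℂ) (v : EuclideanSpace ℝ (Fin 2)) :
    ‖Matrix.toEuclideanLin (!![z.re, z.im; -z.im, z.re] : Matrix (Fin 2) (Fin 2) ℝ) v‖ =
      ‖z‖ * ‖v‖ := by
  rw [← sq_eq_sq₀ (norm_nonneg _) (by positivity), mul_pow, EuclideanSpace.norm_sq_eq,
    EuclideanSpace.norm_sq_eq, Complex.sq_norm, Complex.normSq_apply]
  simp [Matrix.toLpLin_apply, Matrix.mulVec, dotProduct, Fin.sum_univ_two]
  ring

theorem mola_skew_block_norm (k : ℕ) (α γ ω : ℝ) :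
    let J : Matrix (Fin 2) (Fin 2) ℝ := !![0, 1; -1, 0]
    let M : Matrix (Fin 2) (Fin 2) ℝ :=
      (1 - α) • (1 : Matrix (Fin 2) (Fin 2) ℝ) +
        α • ((1 : Matrix (Fin 2) (Fin 2) ℝ) - (γ * ω) • J) ^ k
    ∀ v : EuclideanSpace ℝ (Fin 2),
      ‖Matrix.toEuclideanLin M v‖ =
        ‖(1 - (α : ℂ)) + (α : ℂ) * (1 - Complex.I * ((γ * ω : ℝ) : ℂ)) ^ k‖ * ‖v‖ := by
  intro J M v
  rw [← mola_aux_norm]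
  have h1 : (1 : Matrix (Fin 2) (Fin 2) ℝ) - (γ * ω) • J = !![1, -(γ * ω); γ * ω, 1] := by
    ext i j
    fin_cases i <;> fin_cases j <;> simp [J]
  have h2 : M = (1 - α) • (1 : Matrix (Fin 2) (Fin 2) ℝ) +
      α • (!![1, -(γ * ω); γ * ω, 1] : Matrix (Fin 2) (Fin 2) ℝ) ^ k := by
    rw [← h1]
  rw [h2, mola_aux_pow]
  generalize (1 - Complex.I * ((γ * ω : ℝ) : ℂ)) ^ k = z
  congr 3
  ext i j
  fin_cases i <;> fin_cases j <;> simp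
end

section
/- Let w be a complex number with w ≠ 1 and let α > 0 be real. Then |(1-α) + α·w| < 1 if and only if α < 2·(1 - Re w) / |1 - w|², where Re w is the real part of w, |·| denotes the complex modulus, and |1-w|² is the norm-square of 1 - w. -/
theorem mola_schur_stability_criterion (w : ℂ) (hw : w ≠ 1) (α : ℝ) (hα : 0 < α) :
    ‖(1 - (α : ℂ)) + (α : ℂ) * w‖ < 1 ↔
      α < 2 * (1 - w.re) / Complex.normSq (1 - w) := by
  have hN : 0 < Complex.normSq (1 - w) :=
    Complex.normSq_pos.mpr (sub_ne_zero.mpr hw.symm)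
  have key : ‖(1 - (α : ℂ)) + (α : ℂ) * w‖ ^ 2
      = 1 + α * (α * Complex.normSq (1 - w) - 2 * (1 - w.re)) := by
    rw [← Complex.normSq_eq_norm_sq, Complex.normSq_apply, Complex.normSq_apply]
    simp
    ring
  rw [lt_div_iff₀ hN, ← sq_lt_one_iff₀ (norm_nonneg _), key]
  constructor
  · intro h
    by_contra hc
    have := mul_nonneg hα.le (sub_nonneg.mpr (not_lt.mp hc))
    linarith
  · intro h
    have := mul_neg_of_pos_of_neg hα (sub_neg.mpr h)
    linarith
end
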